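/- arXiv:1701.08325 — 4 statements merged into one kernel-verified Lean document; each statement's English description precedes it below -/
import Mathlib

section
/- Let D be a block design with parameters (v, b, r, k, λ) built on a finite set V. If λ = 1, then D is friends with itself, i.e., for every integer j ≥ 0 the number z_j(D, B) of blocks of D meeting a block B in exactly j elements does not depend on the choice of the block B of D. -/
open Finset

variable {V : Type*}

/-- `zval D M j` is the number of blocks `B` of `D` with `|M ∩ B| = j`. -/
def zval [DecidableEq V] (D : Finset (Finset V)) (M : Finset V) (j : ℕ) : ℕ :=
  (D.filter fun B => (M ∩ B).card = j).card

/-- A (simple) balanced incomplete block design with parameters `(v, b, r, k, lam)`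
built on the finite set `V`. -/
structure IsBIBD [Fintype V] [DecidableEq V] (D : Finset (Finset V))
    (v b r k lam : ℕ) : Prop where
  card_pts : Fintype.card V = v
  card_blocks : D.card = b
  block_size : ∀ B ∈ D, B.card = k
  repl : ∀ x : V, (D.filter fun B => x ∈ B).card = r
  balance : ∀ x y : V, x ≠ y → (D.filter fun B => x ∈ B ∧ y ∈ B).card = lam

/-- Two block designs on the same set `V` are friends if, for every `j`,
`zval D₁ B₂ j` does not depend on the choice of block `B₂` of `D₂`, and
`zval D₂ B₁ j` does not depend on the choice of block `B₁` of `D₁`. -/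
def IsFriends [DecidableEq V] (D₁ D₂ : Finset (Finset V)) : Prop :=
  (∀ j : ℕ, ∀ B ∈ D₂, ∀ B' ∈ D₂, zval D₁ B j = zval D₁ B' j) ∧
  (∀ j : ℕ, ∀ B ∈ D₁, ∀ B' ∈ D₁, zval D₂ B j = zval D₂ B' j)

/-- Two distinct blocks of a design with `lam = 1` share at most one point. -/
theorem IsBIBD.card_inter_le_one [Fintype V] [DecidableEq V] {D : Finset (Finset V)}
    {v b r k : ℕ} (hD : IsBIBD D v b r k 1) {B C : Finset V} (hB : B ∈ D) (hC : C ∈ D)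
    (hne : C ≠ B) : (B ∩ C).card ≤ 1 := by
  refine Finset.card_le_one.2 fun x hx y hy => ?_
  by_contra hxy
  rw [Finset.mem_inter] at hx hy
  refine hne (Finset.card_le_one.1 (hD.balance x y hxy).le C ?_ B ?_)
  · exact Finset.mem_filter.2 ⟨hC, hx.2, hy.2⟩
  · exact Finset.mem_filter.2 ⟨hB, hx.1, hy.1⟩

/-- Counting flags whose point lies in `M`. -/
theorem IsBIBD.sum_card_inter [Fintype V] [DecidableEq V] {D : Finset (Finset V)}
    {v b r k lam : ℕ} (hD : IsBIBD D v b r k lam) (M : Finset V) :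
    ∑ C ∈ D, (M ∩ C).card = M.card * r := by
  rw [Finset.sum_card_inter fun x _ => hD.repl x]

/-- The intersection numbers of a block of a design with `lam = 1`. -/
theorem IsBIBD.zval_eq [Fintype V] [DecidableEq V] {D : Finset (Finset V)}
    {v b r k : ℕ} (hD : IsBIBD D v b r k 1) {B : Finset V} (hB : B ∈ D) (j : ℕ) :
    zval D B j = (if k = j then 1 else 0) +
      (if j = 0 then (b - 1) - (k * r - k) else if j = 1 then k * r - k else 0) := by
  have hle : ∀ C ∈ D.erase B, (B ∩ C).card ≤ 1 := fun C hC =>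
    hD.card_inter_le_one hB (Finset.mem_of_mem_erase hC) (Finset.ne_of_mem_erase hC)
  have hsum : k + ∑ C ∈ D.erase B, (B ∩ C).card = k * r := by
    have h := Finset.add_sum_erase D (fun C => (B ∩ C).card) hB
    rwa [hD.sum_card_inter, Finset.inter_self, hD.block_size B hB] at h
  have hone : ((D.erase B).filter fun C => (B ∩ C).card = 1).card = k * r - k := by
    rw [← hsum, Nat.add_sub_cancel_left, Finset.card_filter]
    refine Finset.sum_congr rfl fun C hC => ?_
    have := hle C hC
    split_ifs <;> omega
  have hzero : ((D.erase B).filter fun C => (B ∩ C).card = 0).card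
      = (b - 1) - (k * r - k) := by
    have h := Finset.card_filter_add_card_filter_not (s := D.erase B)
      (fun C => (B ∩ C).card = 1)
    rw [hone, Finset.card_erase_of_mem hB, hD.card_blocks] at h
    rw [← h, Nat.add_sub_cancel_left]
    congr 1
    refine Finset.filter_congr fun C hC => ?_
    have := hle C hC
    omega
  have hsplit : zval D B j = (if k = j then 1 else 0) +
      ((D.erase B).filter fun C => (B ∩ C).card = j).card := by
    rw [zval, Finset.card_filter, Finset.card_filter, ← Finset.add_sum_erase D _ hB,
      Finset.inter_self, hD.block_size B hB]
  rw [hsplit]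
  congr 1
  split_ifs with h0 h1
  · rw [h0, hzero]
  · rw [h1, hone]
  · refine Finset.card_eq_zero.2 (Finset.filter_eq_empty_iff.2 fun C hC => ?_)
    have := hle C hC
    omega

theorem stmt_4 [Fintype V] [DecidableEq V] (D : Finset (Finset V))
    (v b r k : ℕ) (hD : IsBIBD D v b r k 1) :
    ∀ j : ℕ, ∀ B ∈ D, ∀ B' ∈ D, zval D B j = zval D B' j := by
  intro j B hB B' hB'
  rw [hD.zval_eq hB, hD.zval_eq hB']
end

section
/- Let D be a block design with parameters (v, b, r, k, λ) built on a finite set V. If k = 3, then D is friends with itself, i.e., for every integer j ≥ 0 the number z_j(D, B) of blocks of D meeting a block B in exactly j elements does not depend on the choice of the block B of D. -/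
open Finset

variable {V : Type*}

/-- The number of blocks meeting a three-element block in one, two or three points, together with
the total number of blocks, in terms of the parameters of the design. -/
theorem IsBIBD.zval_relations [Fintype V] [DecidableEq V] {D : Finset (Finset V)}
    {v b r lam : ℕ} (hD : IsBIBD D v b r 3 lam) {M : Finset V} (hM : M ∈ D) :
    zval D M 0 + zval D M 1 + zval D M 2 + zval D M 3 = b ∧
    zval D M 1 + 2 * zval D M 2 + 3 * zval D M 3 = 3 * r ∧
    zval D M 2 + 3 * zval D M 3 = 3 * lam ∧
    zval D M 3 = 1 := by
  have hcard := hD.block_size M hM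
  obtain ⟨x, y, z, hxy, hxz, hyz, rfl⟩ := Finset.card_eq_three.mp hcard
  have hinter (B : Finset V) : (({x, y, z} : Finset V) ∩ B).card =
      (if x ∈ B then 1 else 0) + (if y ∈ B then 1 else 0) + (if z ∈ B then 1 else 0) := by
    rw [← Finset.filter_mem_eq_inter, Finset.card_filter, Finset.sum_insert (by simp [hxy, hxz]),
      Finset.sum_pair hyz, add_assoc]
  refine ⟨?_, ?_, ?_, ?_⟩
  · rw [← hD.card_blocks]
    simp only [zval, hinter, Finset.card_filter, Finset.card_eq_sum_ones D,
      ← Finset.sum_add_distrib]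
    refine Finset.sum_congr rfl fun B _ => ?_
    split_ifs <;> simp_all
  · have h : 3 * r = (D.filter fun B => x ∈ B).card + (D.filter fun B => y ∈ B).card +
        (D.filter fun B => z ∈ B).card := by
      rw [hD.repl, hD.repl, hD.repl]; ring
    rw [h]
    simp only [zval, hinter, Finset.card_filter, Finset.mul_sum, ← Finset.sum_add_distrib]
    refine Finset.sum_congr rfl fun B _ => ?_
    by_cases hx : x ∈ B <;> by_cases hy : y ∈ B <;> by_cases hz : z ∈ B <;> simp [hx, hy, hz]
  · have h : 3 * lam = (D.filter fun B => x ∈ B ∧ y ∈ B).card +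
        (D.filter fun B => x ∈ B ∧ z ∈ B).card + (D.filter fun B => y ∈ B ∧ z ∈ B).card := by
      rw [hD.balance x y hxy, hD.balance x z hxz, hD.balance y z hyz]; ring
    rw [h]
    simp only [zval, hinter, Finset.card_filter, Finset.mul_sum, ← Finset.sum_add_distrib]
    refine Finset.sum_congr rfl fun B _ => ?_
    by_cases hx : x ∈ B <;> by_cases hy : y ∈ B <;> by_cases hz : z ∈ B <;> simp [hx, hy, hz]
  · refine Finset.card_eq_one.mpr ⟨{x, y, z}, ?_⟩
    ext B
    rw [Finset.mem_filter, Finset.mem_singleton]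
    constructor
    · rintro ⟨hB, h⟩
      have h₁ : ({x, y, z} : Finset V) ∩ B = {x, y, z} :=
        Finset.eq_of_subset_of_card_le Finset.inter_subset_left (by rw [h, hcard])
      have h₂ : ({x, y, z} : Finset V) ∩ B = B :=
        Finset.eq_of_subset_of_card_le Finset.inter_subset_right (by rw [h, hD.block_size B hB])
      exact h₂.symm.trans h₁
    · rintro rfl
      exact ⟨hM, by rw [Finset.inter_self, hcard]⟩

/-- No block meets `M` in more than `|M|` points. -/
theorem zval_eq_zero_of_card_lt [DecidableEq V] (D : Finset (Finset V)) {M : Finset V} {j : ℕ}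
    (h : M.card < j) : zval D M j = 0 := by
  refine Finset.card_eq_zero.mpr (Finset.filter_eq_empty_iff.mpr fun B _ hB => ?_)
  have := Finset.card_le_card (Finset.inter_subset_left : M ∩ B ⊆ M)
  omega

theorem stmt_6 [Fintype V] [DecidableEq V] (D : Finset (Finset V))
    (v b r lam : ℕ) (hD : IsBIBD D v b r 3 lam) :
    ∀ j : ℕ, ∀ B ∈ D, ∀ B' ∈ D, zval D B j = zval D B' j := by
  intro j B hB B' hB'
  have h := hD.zval_relations hB
  have h' := hD.zval_relations hB'
  rcases lt_or_ge 3 j with hj | hj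
  · rw [zval_eq_zero_of_card_lt D (by rwa [hD.block_size B hB]),
      zval_eq_zero_of_card_lt D (by rwa [hD.block_size B' hB'])]
  · interval_cases j <;> omega
end

section
/- Let {D_i}_{i ∈ I} be a family of block designs built on a finite set V that are pairwise friends, such that no two distinct members of the family share a block and every subset of V (including the empty set and V itself, regarded as degenerate designs in the family) occurs as a block of exactly one member of the family. For U ⊆ V let α(U) denote the unique member of the family having U as a block. Then α preserves the partial orders: whenever X, Y ⊆ V with X ⊊ Y, the block size k of α(X) is strictly less than the block size of α(Y), and α(X) < α(Y), i.e., the common value z_k(α(X), B) over blocks B of α(Y) is strictly positive. -/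
open Finset

variable {V : Type*}

theorem stmt_13 [Fintype V] [DecidableEq V] {I : Type*}
    (Dfam : I → Finset (Finset V)) (ks bb rr ll : I → ℕ)
    (hBIBD : ∀ i : I, IsBIBD (Dfam i) (Fintype.card V) (bb i) (rr i) (ks i) (ll i))
    (hfriends : ∀ i j : I, i ≠ j → IsFriends (Dfam i) (Dfam j))
    (hdisj : ∀ i j : I, i ≠ j → ∀ B : Finset V, B ∈ Dfam i → B ∉ Dfam j)
    (hcover : ∀ U : Finset V, ∃! i : I, U ∈ Dfam i) :
    ∀ X Y : Finset V, X ⊂ Y → ∀ i j : I, X ∈ Dfam i → Y ∈ Dfam j →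
      ks i < ks j ∧ ∀ B ∈ Dfam j, 0 < zval (Dfam i) B (ks i) := by
  intro X Y hXY i j hX hY
  have hcX := (hBIBD i).block_size X hX
  have hlt : ks i < ks j := by
    rw [← hcX, ← (hBIBD j).block_size Y hY]
    exact card_lt_card hXY
  have hij : i ≠ j := by
    rintro rfl
    exact lt_irrefl _ hlt
  refine ⟨hlt, fun B hB => ?_⟩
  rw [(hfriends i j hij).1 (ks i) B hB Y hY]
  refine card_pos.mpr ⟨X, mem_filter.mpr ⟨hX, ?_⟩⟩
  rw [inter_eq_right.mpr hXY.subset, hcX]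
end

section
/- Let D be a block design with parameters (v, b, r, 3, 1) built on a finite set V (block size k = 3 and λ = 1), with v ≥ 4. Let D₁^{(4)} be the collection of all 4-element subsets of V that contain at least one block of D. Then D₁^{(4)} is a block design on V with parameters (v, b(v − 3), r(v − 3) + (b − r), 4, (v − 3) + 2(r − 1)). -/
open Finset

variable {V : Type*}

/-- In a design with `k = 3` and `λ = 1`, a 4-set contains at most one block. -/
lemma IsBIBD.eq_of_subset_of_card_eq_four [Fintype V] [DecidableEq V] {D : Finset (Finset V)}
    {v b r : ℕ} (hD : IsBIBD D v b r 3 1) {B B' T : Finset V} (hB : B ∈ D) (hB' : B' ∈ D)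
    (hT : T.card = 4) (hBT : B ⊆ T) (hBT' : B' ⊆ T) : B = B' := by
  have h1 := card_union_add_card_inter B B'
  have h2 := card_le_card (union_subset hBT hBT')
  rw [hD.block_size B hB, hD.block_size B' hB'] at h1
  obtain ⟨x, hx, y, hy, hxy⟩ := one_lt_card.1 (show 1 < (B ∩ B').card by omega)
  rw [mem_inter] at hx hy
  exact card_le_one.1 (hD.balance x y hxy).le B (mem_filter.2 ⟨hB, hx.1, hy.1⟩)
    B' (mem_filter.2 ⟨hB', hx.2, hy.2⟩)

/-- A 4-set containing a block is counted through its unique decomposition into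
a block and an additional point. -/
lemma IsBIBD.card_filter_four_sets [Fintype V] [DecidableEq V] {D : Finset (Finset V)}
    {v b r : ℕ} (hD : IsBIBD D v b r 3 1) (P : Finset V → Prop) [DecidablePred P] :
    (((powersetCard 4 (univ : Finset V)).filter fun T => ∃ B ∈ D, B ⊆ T).filter P).card =
      ∑ B ∈ D, (Bᶜ.filter fun z => P (insert z B)).card := by
  have hcard : ∀ B ∈ D, ∀ z ∉ B, (insert z B).card = 4 := fun B hB z hz => by
    rw [card_insert_of_notMem hz, hD.block_size B hB]
  have hunion : ((powersetCard 4 (univ : Finset V)).filter fun T => ∃ B ∈ D, B ⊆ T).filter P =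
      D.biUnion fun B => (Bᶜ.filter fun z => P (insert z B)).image (insert · B) := by
    ext T
    simp only [mem_filter, mem_powersetCard_univ, mem_biUnion, mem_image, mem_compl]
    constructor
    · rintro ⟨⟨hT, B, hB, hBT⟩, hP⟩
      have h := card_sdiff_add_card_eq_card hBT
      rw [hD.block_size B hB, hT] at h
      obtain ⟨z, hz⟩ := card_eq_one.1 (show (T \ B).card = 1 by omega)
      have hzB : insert z B = T := by
        rw [insert_eq, ← hz, sdiff_union_of_subset hBT]
      have hz' : z ∈ T \ B := by simp [hz]
      exact ⟨B, hB, z, ⟨(mem_sdiff.1 hz').2, hzB ▸ hP⟩, hzB⟩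
    · rintro ⟨B, hB, z, ⟨hz, hP⟩, rfl⟩
      exact ⟨⟨hcard B hB z hz, B, hB, subset_insert z B⟩, hP⟩
  rw [hunion, card_biUnion]
  · refine sum_congr rfl fun B _ => card_image_of_injOn fun z hz w _ hzw => ?_
    have hz' := (mem_filter.1 (mem_coe.1 hz)).1
    have : z ∈ insert w B := hzw ▸ mem_insert_self z B
    exact (mem_insert.1 this).resolve_right (mem_compl.1 hz')
  · intro B hB B' hB' hne
    rw [Function.onFun, disjoint_left]
    intro T hT hT'
    simp only [mem_image, mem_filter, mem_compl] at hT hT'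
    obtain ⟨z, ⟨hz, _⟩, rfl⟩ := hT
    obtain ⟨w, _, hw⟩ := hT'
    exact hne (hD.eq_of_subset_of_card_eq_four hB hB' (hcard B hB z hz) (subset_insert z B)
      (hw ▸ subset_insert w B'))

theorem stmt_17 [Fintype V] [DecidableEq V] (D : Finset (Finset V))
    (v b r : ℕ) (hD : IsBIBD D v b r 3 1) (hv : 4 ≤ v) :
    IsBIBD ((Finset.powersetCard 4 (Finset.univ : Finset V)).filter
        fun T => ∃ B ∈ D, B ⊆ T)
      v (b * (v - 3)) (r * (v - 3) + (b - r)) 4 ((v - 3) + 2 * (r - 1)) := by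
  have hcompl : ∀ B ∈ D, Bᶜ.card = v - 3 := fun B hB => by
    rw [card_compl, hD.card_pts, hD.block_size B hB]
  refine ⟨hD.card_pts, ?_, ?_, ?_, ?_⟩
  · have h := hD.card_filter_four_sets fun _ => True
    simp only [filter_true] at h
    rw [h, sum_congr rfl hcompl, sum_const, smul_eq_mul, hD.card_blocks]
  · intro T hT
    exact (mem_powersetCard.1 (mem_filter.1 hT).1).2
  · intro x
    rw [hD.card_filter_four_sets fun T => x ∈ T]
    have hterm : ∀ B ∈ D, (Bᶜ.filter fun z => x ∈ insert z B).card + (if x ∈ B then 1 else 0) =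
        (if x ∈ B then 1 else 0) * (v - 3) + 1 := fun B hB => by
      by_cases hx : x ∈ B
      · simp [hx, hcompl B hB]
      · simp [hx, filter_eq]
    have hsum := sum_congr rfl hterm
    rw [sum_add_distrib, sum_add_distrib, ← sum_mul, ← card_filter, hD.repl x, sum_const,
      smul_eq_mul, mul_one, hD.card_blocks] at hsum
    have hrb : r ≤ b := by
      rw [← hD.repl x, ← hD.card_blocks]
      exact card_filter_le _ _
    omega
  · intro x y hxy
    rw [hD.card_filter_four_sets fun T => x ∈ T ∧ y ∈ T]
    have hterm : ∀ B ∈ D, (Bᶜ.filter fun z => x ∈ insert z B ∧ y ∈ insert z B).card +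
        (if x ∈ B ∧ y ∈ B then 1 else 0) * 2 = (if x ∈ B ∧ y ∈ B then 1 else 0) * (v - 3) +
          (if x ∈ B then 1 else 0) + (if y ∈ B then 1 else 0) := fun B hB => by
      by_cases hx : x ∈ B <;> by_cases hy : y ∈ B
      · simp [hx, hy, hcompl B hB]
      · simp [hx, hy, filter_eq]
      · simp [hx, hy, filter_eq]
      · simp only [mem_insert, hx, hy, or_false, and_false, if_false, zero_mul, add_zero,
          card_eq_zero, filter_eq_empty_iff]
        rintro z - ⟨rfl, rfl⟩
        exact hxy rfl
    have hsum := sum_congr rfl hterm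
    rw [sum_add_distrib, sum_add_distrib, sum_add_distrib, ← sum_mul, ← sum_mul, ← card_filter,
      ← card_filter, ← card_filter, hD.repl x, hD.repl y, hD.balance x y hxy] at hsum
    have hr : 1 ≤ r := by
      rw [← hD.balance x y hxy, ← hD.repl x]
      exact card_le_card (monotone_filter_right _ fun _ _ h => h.1)
    omega
end
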